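/- arXiv:1506.09142 — 5 statements merged into one kernel-verified Lean document; each statement's English description precedes it below -/
import Mathlib

section
/- Assume that for every M ∈ Γ₀ the matrix M^{-1}B^{-1}M^δ A does not have 1 as an eigenvalue (equivalently, BM − M^δ A is invertible for every M ∈ Γ₀). Then for all v₁, v₂ ∈ K^n and all M₁, M₂ ∈ Γ₀ there exist unique u, z ∈ K^n and a unique M ∈ Γ₀ such that g(u, Bu, M) · g(0, v₁, M₁) = g(0, v₂, M₂) · g(z, Az, I); moreover the solution is M = M₂M₁^{-1}, z = (BM₂ − M₂^δ A)^{-1}(v₂ − M₂^δ (M₁^δ)^{-1} v₁), and u = M₂ z. -/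
open Matrix

/-- The block matrix `g(u,v,M)` (with `Md = M^δ`): block rows `(1,0,0)`, `(u,M,0)`, `(v,0,Md)`. -/
def gmat {K : Type*} [Field K] {n : ℕ} (u v : Fin n → K)
    (M Md : Matrix (Fin n) (Fin n) K) :
    Matrix (Unit ⊕ Fin n ⊕ Fin n) (Unit ⊕ Fin n ⊕ Fin n) K :=
  Matrix.fromBlocks 1 0 (Matrix.of fun i _ => Sum.elim u v i) (Matrix.fromBlocks M 0 0 Md)

/-- The underlying matrix of an element of a subgroup of `GL (Fin n) K`. -/
def mOf {K : Type*} [Field K] {n : ℕ} {Γ₀ : Subgroup (GL (Fin n) K)} (M : Γ₀) :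
    Matrix (Fin n) (Fin n) K := ((M : GL (Fin n) K) : Matrix (Fin n) (Fin n) K)

section

variable {K : Type*} [Field K] {n : ℕ}

theorem gmat_mul_gmat (u v u' v' : Fin n → K) (M Md M' Md' : Matrix (Fin n) (Fin n) K) :
    gmat u v M Md * gmat u' v' M' Md' =
      gmat (u + M *ᵥ u') (v + Md *ᵥ v') (M * M') (Md * Md') := by
  simp only [gmat, fromBlocks_multiply, Matrix.mul_zero, Matrix.zero_mul, add_zero, zero_add,
    Matrix.mul_one]
  congr 1
  ext (i | i) j <;> simp [Matrix.mul_apply, mulVec, dotProduct]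

theorem gmat_inj {u v u' v' : Fin n → K} {M Md M' Md' : Matrix (Fin n) (Fin n) K} :
    gmat u v M Md = gmat u' v' M' Md' ↔ u = u' ∧ v = v' ∧ M = M' ∧ Md = Md' := by
  refine ⟨fun h => ?_, by rintro ⟨rfl, rfl, rfl, rfl⟩; rfl⟩
  obtain ⟨-, -, hcol, hdiag⟩ := fromBlocks_inj.1 h
  obtain ⟨hM, -, -, hMd⟩ := fromBlocks_inj.1 hdiag
  exact ⟨funext fun i => congrFun₂ hcol (Sum.inl i) (),
    funext fun i => congrFun₂ hcol (Sum.inr i) (), hM, hMd⟩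

variable {Γ₀ : Subgroup (GL (Fin n) K)}

theorem mOf_mul (M N : Γ₀) : mOf (M * N) = mOf M * mOf N := rfl

theorem mOf_one : mOf (1 : Γ₀) = 1 := rfl

theorem mOf_injective : Function.Injective (mOf : Γ₀ → Matrix (Fin n) (Fin n) K) :=
  fun _ _ h => Subtype.ext (Units.ext h)

theorem isUnit_det_sub_of_det_ne_zero (A B : GL (Fin n) K) (M N : Γ₀)
    (h : (mOf M⁻¹ * ((B⁻¹ : GL (Fin n) K) : Matrix (Fin n) (Fin n) K) * mOf N *
      (A : Matrix (Fin n) (Fin n) K) - 1).det ≠ 0) :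
    IsUnit ((B : Matrix (Fin n) (Fin n) K) * mOf M -
      mOf N * (A : Matrix (Fin n) (Fin n) K)).det := by
  have hM : mOf M * mOf M⁻¹ = 1 := by rw [← mOf_mul, mul_inv_cancel, mOf_one]
  have hB : (B : Matrix (Fin n) (Fin n) K) * ((B⁻¹ : GL (Fin n) K) : Matrix (Fin n) (Fin n) K) =
      1 := B.mul_inv
  have key : (B : Matrix (Fin n) (Fin n) K) * mOf M - mOf N * (A : Matrix (Fin n) (Fin n) K) =
      -((B : Matrix (Fin n) (Fin n) K) * mOf M *
        (mOf M⁻¹ * ((B⁻¹ : GL (Fin n) K) : Matrix (Fin n) (Fin n) K) * mOf N *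
          (A : Matrix (Fin n) (Fin n) K) - 1)) := by
    have : (B : Matrix (Fin n) (Fin n) K) * mOf M *
        (mOf M⁻¹ * ((B⁻¹ : GL (Fin n) K) : Matrix (Fin n) (Fin n) K) * mOf N *
          (A : Matrix (Fin n) (Fin n) K)) = mOf N * (A : Matrix (Fin n) (Fin n) K) := by
      calc _ = (B : Matrix (Fin n) (Fin n) K) * (mOf M * mOf M⁻¹) *
            ((B⁻¹ : GL (Fin n) K) : Matrix (Fin n) (Fin n) K) * mOf N *
            (A : Matrix (Fin n) (Fin n) K) := by simp only [Matrix.mul_assoc]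
        _ = _ := by rw [hM, Matrix.mul_one, hB, Matrix.one_mul]
    rw [Matrix.mul_sub, this, Matrix.mul_one, neg_sub]
  rw [← isUnit_iff_isUnit_det, key, IsUnit.neg_iff]
  exact (B.isUnit.mul (M : GL (Fin n) K).isUnit).mul
    ((isUnit_iff_isUnit_det _).2 (isUnit_iff_ne_zero.2 h))

theorem gmat_mul_eq_gmat_mul_iff (δ : Γ₀ →* Γ₀) (A B : GL (Fin n) K) (v₁ v₂ : Fin n → K)
    (M₁ M₂ : Γ₀)
    (hdet : IsUnit ((B : Matrix (Fin n) (Fin n) K) * mOf M₂ -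
      mOf (δ M₂) * (A : Matrix (Fin n) (Fin n) K)).det)
    (u z : Fin n → K) (M : Γ₀) :
    gmat u ((B : Matrix (Fin n) (Fin n) K) *ᵥ u) (mOf M) (mOf (δ M)) *
          gmat 0 v₁ (mOf M₁) (mOf (δ M₁)) =
        gmat 0 v₂ (mOf M₂) (mOf (δ M₂)) *
          gmat z ((A : Matrix (Fin n) (Fin n) K) *ᵥ z) 1 1 ↔
      u = mOf M₂ *ᵥ z ∧ M = M₂ * M₁⁻¹ ∧
        z = ((B : Matrix (Fin n) (Fin n) K) * mOf M₂ -
            mOf (δ M₂) * (A : Matrix (Fin n) (Fin n) K))⁻¹ *ᵥ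
          (v₂ - (mOf (δ M₂) * mOf (δ M₁)⁻¹) *ᵥ v₁) := by
  have hsolve (w : Fin n → K) :
      z = ((B : Matrix (Fin n) (Fin n) K) * mOf M₂ -
          mOf (δ M₂) * (A : Matrix (Fin n) (Fin n) K))⁻¹ *ᵥ w ↔
        ((B : Matrix (Fin n) (Fin n) K) * mOf M₂ -
          mOf (δ M₂) * (A : Matrix (Fin n) (Fin n) K)) *ᵥ z = w := by
    constructor
    · rintro rfl
      rw [mulVec_mulVec, mul_nonsing_inv _ hdet, one_mulVec]
    · rintro rfl
      rw [mulVec_mulVec, nonsing_inv_mul _ hdet, one_mulVec]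
  rw [hsolve, gmat_mul_gmat, gmat_mul_gmat, gmat_inj]
  simp only [mulVec_zero, add_zero, zero_add, Matrix.mul_one, ← mOf_mul, ← map_mul,
    mOf_injective.eq_iff]
  refine and_congr_right fun hu => ?_
  have hM : (M * M₁ = M₂ ∧ δ (M * M₁) = δ M₂) ↔ M = M₂ * M₁⁻¹ := by
    rw [eq_mul_inv_iff_mul_eq, and_iff_left_iff_imp]
    exact congrArg δ
  rw [hM, and_comm]
  refine and_congr_right fun hM => ?_
  rw [hu, hM, sub_mulVec, sub_eq_sub_iff_add_eq_add, mulVec_mulVec, mulVec_mulVec, map_mul, map_inv]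

end

theorem stmt1 (K : Type*) [Field K] (n : ℕ) (hn : 1 ≤ n)
    (Γ₀ : Subgroup (GL (Fin n) K)) (δ : Γ₀ →* Γ₀) (A B : GL (Fin n) K)
    -- no M⁻¹B⁻¹M^δA has eigenvalue 1
    (heig : ∀ M : Γ₀,
      (mOf (M⁻¹) * ((B⁻¹ : GL (Fin n) K) : Matrix (Fin n) (Fin n) K) * mOf (δ M) *
          (A : Matrix (Fin n) (Fin n) K) - 1).det ≠ 0)
    (v₁ v₂ : Fin n → K) (M₁ M₂ : Γ₀) :
    -- there exist unique u, z ∈ Kⁿ and M ∈ Γ₀ with g(u,Bu,M)·g(0,v₁,M₁) = g(0,v₂,M₂)·g(z,Az,I)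
    (∃! t : (Fin n → K) × Γ₀ × (Fin n → K),
        gmat t.1 ((B : Matrix (Fin n) (Fin n) K).mulVec t.1) (mOf t.2.1) (mOf (δ t.2.1)) *
            gmat 0 v₁ (mOf M₁) (mOf (δ M₁)) =
          gmat 0 v₂ (mOf M₂) (mOf (δ M₂)) *
            gmat t.2.2 ((A : Matrix (Fin n) (Fin n) K).mulVec t.2.2) 1 1) ∧
    -- moreover the solution is M = M₂M₁⁻¹, z = (BM₂ − M₂^δA)⁻¹(v₂ − M₂^δ(M₁^δ)⁻¹v₁), u = M₂z
    (let z : Fin n → K :=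
        (((B : Matrix (Fin n) (Fin n) K) * mOf M₂ -
            mOf (δ M₂) * (A : Matrix (Fin n) (Fin n) K))⁻¹).mulVec
          (v₂ - (mOf (δ M₂) * mOf ((δ M₁)⁻¹)).mulVec v₁);
      gmat ((mOf M₂).mulVec z)
            ((B : Matrix (Fin n) (Fin n) K).mulVec ((mOf M₂).mulVec z))
            (mOf (M₂ * M₁⁻¹)) (mOf (δ (M₂ * M₁⁻¹))) *
          gmat 0 v₁ (mOf M₁) (mOf (δ M₁)) =
        gmat 0 v₂ (mOf M₂) (mOf (δ M₂)) *
          gmat z ((A : Matrix (Fin n) (Fin n) K).mulVec z) 1 1) := by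
  have hiff := gmat_mul_eq_gmat_mul_iff δ A B v₁ v₂ M₁ M₂
    (isUnit_det_sub_of_det_ne_zero A B M₂ (δ M₂) (heig M₂))
  have hsol := (hiff _ _ _).2 ⟨rfl, rfl, rfl⟩
  refine ⟨⟨(_, _, _), hsol, ?_⟩, hsol⟩
  rintro ⟨u, M, z⟩ h
  obtain ⟨rfl, rfl, rfl⟩ := (hiff u z M).1 h
  rfl
end

section
/- Assume that for every M ∈ Γ₀ the matrix M^{-1}B^{-1}M^δ A does not have 1 as an eigenvalue. Then the multiplication ∗ on K^n × Γ₀ makes K^n × Γ₀ into a loop: (0,I) is a two-sided identity element, and for all a, b ∈ K^n × Γ₀ there is a unique y with a ∗ y = b and a unique x with x ∗ a = b. -/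
open Matrix

/-- The loop multiplication (u₁,M₁) ∗ (u₂,M₂) = (u₁ + ψ(u₂), M₁M₂) on Kⁿ × Γ₀, where
ψ = [B − (M₁M₂)^δ A (M₁M₂)⁻¹]⁻¹ [M₁^δ (B − M₂^δ A M₂⁻¹)]. -/
noncomputable def lmul {K : Type*} [Field K] {n : ℕ} {Γ₀ : Subgroup (GL (Fin n) K)}
    (δ : Γ₀ →* Γ₀) (A B : GL (Fin n) K)
    (p q : (Fin n → K) × Γ₀) : (Fin n → K) × Γ₀ :=
  (p.1 +
    (((B : Matrix (Fin n) (Fin n) K) -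
          mOf (δ (p.2 * q.2)) * (A : Matrix (Fin n) (Fin n) K) * mOf ((p.2 * q.2)⁻¹))⁻¹ *
        (mOf (δ p.2) *
          ((B : Matrix (Fin n) (Fin n) K) -
            mOf (δ q.2) * (A : Matrix (Fin n) (Fin n) K) * mOf (q.2⁻¹)))).mulVec q.1,
    p.2 * q.2)

/-- The matrix `B - M^δ A M⁻¹` is invertible when `M⁻¹ B⁻¹ M^δ A` has no eigenvalue `1`. -/
lemma isUnit_sub_of_det_ne_zero {K : Type*} [Field K] {n : ℕ} {Γ₀ : Subgroup (GL (Fin n) K)}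
    (δ : Γ₀ →* Γ₀) (A B : GL (Fin n) K) (M : Γ₀)
    (h : (mOf (M⁻¹) * ((B⁻¹ : GL (Fin n) K) : Matrix (Fin n) (Fin n) K) * mOf (δ M) *
          (A : Matrix (Fin n) (Fin n) K) - 1).det ≠ 0) :
    IsUnit ((B : Matrix (Fin n) (Fin n) K) -
      mOf (δ M) * (A : Matrix (Fin n) (Fin n) K) * mOf (M⁻¹)) := by
  have hM : mOf M * mOf (M⁻¹) = 1 := by
    simp only [mOf, ← Units.val_mul, ← Subgroup.coe_mul, mul_inv_cancel]
    rfl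
  have hB : (B : Matrix (Fin n) (Fin n) K) *
      ((B⁻¹ : GL (Fin n) K) : Matrix (Fin n) (Fin n) K) = 1 :=
    Units.mul_inv B
  have key : (B : Matrix (Fin n) (Fin n) K) -
      mOf (δ M) * (A : Matrix (Fin n) (Fin n) K) * mOf (M⁻¹) =
      -(B * mOf M * (mOf (M⁻¹) * ((B⁻¹ : GL (Fin n) K) : Matrix (Fin n) (Fin n) K) * mOf (δ M) *
          (A : Matrix (Fin n) (Fin n) K) - 1) * mOf (M⁻¹)) := by
    have h₁ : (B : Matrix (Fin n) (Fin n) K) * mOf M * (mOf (M⁻¹) *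
        ((B⁻¹ : GL (Fin n) K) : Matrix (Fin n) (Fin n) K) * mOf (δ M) * A) * mOf (M⁻¹) =
        B * (mOf M * mOf (M⁻¹)) * ((B⁻¹ : GL (Fin n) K) : Matrix (Fin n) (Fin n) K) *
          mOf (δ M) * A * mOf (M⁻¹) := by
      simp only [mul_assoc]
    rw [mul_sub, sub_mul, h₁, hM, mul_one, mul_one, hB, one_mul,
      mul_assoc (B : Matrix (Fin n) (Fin n) K), hM,
      mul_one, neg_sub]
  rw [key]
  exact (((B.isUnit.mul (M : GL (Fin n) K).isUnit).mul
    ((isUnit_iff_isUnit_det _).2 h.isUnit)).mul ((M⁻¹ : Γ₀) : GL (Fin n) K).isUnit).neg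

theorem stmt2 (K : Type*) [Field K] (n : ℕ) (hn : 1 ≤ n)
    (Γ₀ : Subgroup (GL (Fin n) K)) (δ : Γ₀ →* Γ₀) (A B : GL (Fin n) K)
    -- no M⁻¹B⁻¹M^δA has eigenvalue 1
    (heig : ∀ M : Γ₀,
      (mOf (M⁻¹) * ((B⁻¹ : GL (Fin n) K) : Matrix (Fin n) (Fin n) K) * mOf (δ M) *
          (A : Matrix (Fin n) (Fin n) K) - 1).det ≠ 0) :
    -- (0,I) is a two-sided identity
    (∀ a : (Fin n → K) × Γ₀, lmul δ A B (0, 1) a = a ∧ lmul δ A B a (0, 1) = a) ∧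
    -- unique solvability of a ∗ y = b
    (∀ a b : (Fin n → K) × Γ₀, ∃! y : (Fin n → K) × Γ₀, lmul δ A B a y = b) ∧
    -- unique solvability of x ∗ a = b
    (∀ a b : (Fin n → K) × Γ₀, ∃! x : (Fin n → K) × Γ₀, lmul δ A B x a = b) := by
  have hU := fun M => isUnit_sub_of_det_ne_zero δ A B M (heig M)
  refine ⟨fun a => ⟨?_, ?_⟩, fun a b => ?_, fun a b => ?_⟩
  · have h₁ : mOf (δ (1 : Γ₀)) = 1 := by rw [map_one]; rfl
    ext1
    · simp only [lmul, one_mul, h₁, zero_add]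
      rw [nonsing_inv_mul _ ((isUnit_iff_isUnit_det _).1 (hU a.2)), one_mulVec]
    · simp [lmul]
  · simp [lmul]
  · obtain ⟨u, M⟩ := a
    obtain ⟨v, N⟩ := b
    set P := ((B : Matrix (Fin n) (Fin n) K) - mOf (δ N) * A * mOf (N⁻¹))⁻¹ *
      (mOf (δ M) * ((B : Matrix (Fin n) (Fin n) K) -
        mOf (δ (M⁻¹ * N)) * A * mOf ((M⁻¹ * N)⁻¹))) with hP
    have hPu : IsUnit P.det := (isUnit_iff_isUnit_det _).1
      ((isUnit_nonsing_inv_iff.2 (hU N)).mul (((δ M : Γ₀) : GL (Fin n) K).isUnit.mul (hU _)))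
    refine ⟨(P⁻¹ *ᵥ (v - u), M⁻¹ * N), ?_, ?_⟩
    · simp only [lmul, mul_inv_cancel_left]
      rw [← hP, mulVec_mulVec, mul_nonsing_inv _ hPu, one_mulVec, add_sub_cancel]
    · rintro ⟨w, L⟩ hw
      simp only [lmul, Prod.mk.injEq] at hw
      obtain ⟨hw, hL⟩ := hw
      obtain rfl : L = M⁻¹ * N := eq_inv_mul_of_mul_eq hL
      rw [hL, ← hP] at hw
      rw [← hw, add_sub_cancel_left, mulVec_mulVec, nonsing_inv_mul _ hPu, one_mulVec]
  · obtain ⟨u, M⟩ := a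
    obtain ⟨v, N⟩ := b
    refine ⟨(v - (lmul δ A B (0, N * M⁻¹) (u, M)).1, N * M⁻¹), ?_, ?_⟩
    · simp [lmul]
    · rintro ⟨w, L⟩ hw
      simp only [lmul, Prod.mk.injEq] at hw
      obtain ⟨hw, hL⟩ := hw
      obtain rfl : L = N * M⁻¹ := eq_mul_inv_of_mul_eq hL
      simp only [lmul, ← hw, zero_add, add_sub_cancel_right]
end

section
/- Let Γ₀ be a subgroup of the group of invertible upper triangular n×n matrices over K, and for i = 1,…,n let Φ_i = {M_{ii} : M ∈ Γ₀} ⊆ K^* be the set of i-th diagonal entries of elements of Γ₀. Let t₁,…,t_n ∈ K^* satisfy t_i ∉ Φ_i for every i, and set D = diag(t₁,…,t_n). Then for every M ∈ Γ₀ the matrix M^{-1}D does not have 1 as an eigenvalue, i.e. det(M^{-1}D − I) ≠ 0. -/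
open Matrix

theorem stmt15 (K : Type*) [Field K] (n : ℕ) (hn : 1 ≤ n)
    (Γ₀ : Subgroup (GL (Fin n) K))
    -- Γ₀ consists of (invertible) upper triangular matrices
    (hUT : ∀ M : Γ₀, (mOf M).BlockTriangular (id : Fin n → Fin n))
    (t : Fin n → K)
    -- the tᵢ are nonzero …
    (ht0 : ∀ i, t i ≠ 0)
    -- … and tᵢ ∉ Φᵢ = {Mᵢᵢ : M ∈ Γ₀} for each i
    (htΦ : ∀ i, ∀ M : Γ₀, mOf M i i ≠ t i) :
    -- then no M⁻¹·diag(t₁,…,tₙ) has eigenvalue 1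
    ∀ M : Γ₀, ((mOf M)⁻¹ * Matrix.diagonal t - 1).det ≠ 0 := by
  intro M hdet
  have hM : IsUnit (mOf M).det := (Matrix.isUnit_iff_isUnit_det _).1 (M : GL (Fin n) K).isUnit
  have hmul : mOf M * ((mOf M)⁻¹ * Matrix.diagonal t - 1) = Matrix.diagonal t - mOf M := by
    rw [mul_sub, mul_one, Matrix.mul_nonsing_inv_cancel_left _ _ hM]
  have htri : (Matrix.diagonal t - mOf M).BlockTriangular (id : Fin n → Fin n) :=
    (Matrix.blockTriangular_diagonal t).sub (hUT M)
  have hzero : (Matrix.diagonal t - mOf M).det = 0 := by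
    rw [← hmul, Matrix.det_mul, hdet, mul_zero]
  rw [Matrix.det_of_isUpperTriangular htri, Finset.prod_eq_zero_iff] at hzero
  obtain ⟨i, -, hi⟩ := hzero
  rw [Matrix.sub_apply, Matrix.diagonal_apply_eq, sub_eq_zero] at hi
  exact htΦ i M hi.symm
end

section
/- Let F be a subfield of a commutative field K, let t, c ∈ F be such that ct is a square in F, and let a ∈ K with a ∉ F. Set B = [[1, −t],[0, 1]] and A = [[a, 0],[c, a]] (2×2 matrices over K). Then for every M ∈ SL(2,F) (viewed inside SL(2,K)) the matrix M^{-1}B^{-1}MA does not have 1 as an eigenvalue; equivalently det(M^{-1}B^{-1}MA − I) ≠ 0. -/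
open Matrix

/-- The conjugate of an upper unitriangular `2 × 2` matrix by a matrix of determinant one. -/
theorem inv_mul_inv_unitriangular_mul {R : Type*} [CommRing R] (t : R)
    (M : Matrix (Fin 2) (Fin 2) R) (hM : M.det = 1) :
    M⁻¹ * (!![1, -t; 0, 1] : Matrix (Fin 2) (Fin 2) R)⁻¹ * M =
      !![1 + t * M 1 0 * M 1 1, t * M 1 1 ^ 2; -(t * M 1 0 ^ 2), 1 - t * M 1 0 * M 1 1] := by
  have hB : (!![1, -t; 0, 1] : Matrix (Fin 2) (Fin 2) R)⁻¹ = !![1, t; 0, 1] := by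
    simp [inv_def, adjugate_fin_two, det_fin_two]
  have hMinv : M⁻¹ = !![M 1 1, -M 0 1; -M 1 0, M 0 0] := by
    simp [inv_def, adjugate_fin_two, hM]
  rw [det_fin_two] at hM
  rw [hB, hMinv]
  ext i j
  fin_cases i <;> fin_cases j <;> simp [mul_apply, Fin.sum_univ_two]
  · linear_combination hM
  · ring
  · ring
  · linear_combination hM

theorem stmt17 (K : Type*) [Field K] (F : Subfield K) (t c : K)
    (ht : t ∈ F) (hc : c ∈ F)
    -- ct is a square in F
    (hsq : ∃ s ∈ F, s ^ 2 = c * t)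
    (a : K) (ha : a ∉ F) :
    -- B = [[1,−t],[0,1]], A = [[a,0],[c,a]]; for every M ∈ SL(2,F) ⊆ SL(2,K)
    -- the matrix M⁻¹B⁻¹MA has no eigenvalue 1
    ∀ M : Matrix (Fin 2) (Fin 2) K, (∀ i j, M i j ∈ F) → M.det = 1 →
      (M⁻¹ * (!![1, -t; 0, 1] : Matrix (Fin 2) (Fin 2) K)⁻¹ * M *
          (!![a, 0; c, a] : Matrix (Fin 2) (Fin 2) K) - 1).det ≠ 0 := by
  intro M hMF hM h
  obtain ⟨s, hs, hsct⟩ := hsq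
  rw [inv_mul_inv_unitriangular_mul t M hM, det_fin_two] at h
  simp at h
  have hsM : s * M 1 1 ∈ F := F.mul_mem hs (hMF 1 1)
  have hfac : (a - 1) ^ 2 = (s * M 1 1) ^ 2 := by
    linear_combination h - M 1 1 ^ 2 * hsct
  rcases sq_eq_sq_iff_eq_or_eq_neg.mp hfac with h1 | h1
  · exact ha (sub_add_cancel a 1 ▸ h1 ▸ F.add_mem hsM F.one_mem)
  · exact ha (sub_add_cancel a 1 ▸ h1 ▸ F.add_mem (F.neg_mem hsM) F.one_mem)
end

section
/- Let K be a commutative field, Ω a subgroup of K^*, d ∈ K, and let Γ₀ = { g(m,n) = [[m, n],[0, m^{-1}]] : m ∈ Ω, n ∈ K }, with δ : Γ₀ → Γ₀ the endomorphism g(m,n) ↦ g(m, dn). Let B = [[a^{-1}, −b],[0, a]] and A = [[r, s],[0, r^{-1}]] with a, r ∈ K^*, b, s ∈ K, and assume ar ≠ 1. Then for every M ∈ Γ₀ the trace of S_M = M^{-1}B^{-1}M^δ A equals ar + a^{-1}r^{-1}, and S_M does not have 1 as an eigenvalue, i.e. det(S_M − I) ≠ 0. -/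
open Matrix

/-- The matrix `g(m,n) = [[m, n],[0, m⁻¹]]`. -/
def gmn {K : Type*} [Field K] (m : Kˣ) (n : K) : Matrix (Fin 2) (Fin 2) K :=
  !![(m : K), n; 0, ((m⁻¹ : Kˣ) : K)]

/-- The inverse of a determinant-one upper triangular `2 × 2` matrix. -/
theorem inv_upperTriangular_of_mul_eq_one {K : Type*} [Field K] {u v : K} (x : K)
    (h : u * v = 1) :
    (!![u, x; 0, v] : Matrix (Fin 2) (Fin 2) K)⁻¹ = !![v, -x; 0, u] := by
  apply Matrix.inv_eq_right_inv
  ext i j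
  fin_cases i <;> fin_cases j <;> simp [Matrix.mul_apply, Fin.sum_univ_two, h, mul_comm v u]; ring

theorem stmt19 (K : Type*) [Field K] (Ω : Subgroup Kˣ) (d : K)
    (a r : Kˣ) (b s : K)
    (har : (a : K) * (r : K) ≠ 1) :
    -- B = [[a⁻¹,−b],[0,a]], A = [[r,s],[0,r⁻¹]]; δ : g(m,n) ↦ g(m,dn); for every
    -- M = g(m,n) ∈ Γ₀ the matrix S_M = M⁻¹B⁻¹M^δA has trace ar + a⁻¹r⁻¹ and
    -- no eigenvalue 1
    ∀ m ∈ Ω, ∀ n : K,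
      ((gmn m n)⁻¹ *
            (!![((a⁻¹ : Kˣ) : K), -b; 0, (a : K)] : Matrix (Fin 2) (Fin 2) K)⁻¹ *
            gmn m (d * n) *
            (!![(r : K), s; 0, ((r⁻¹ : Kˣ) : K)] : Matrix (Fin 2) (Fin 2) K)).trace =
          (a : K) * (r : K) + ((a⁻¹ : Kˣ) : K) * ((r⁻¹ : Kˣ) : K) ∧
      ((gmn m n)⁻¹ *
            (!![((a⁻¹ : Kˣ) : K), -b; 0, (a : K)] : Matrix (Fin 2) (Fin 2) K)⁻¹ *
            gmn m (d * n) *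
            (!![(r : K), s; 0, ((r⁻¹ : Kˣ) : K)] : Matrix (Fin 2) (Fin 2) K) - 1).det ≠ 0 := by
  intro m _ n
  have hm : (m : K) ≠ 0 := m.ne_zero
  have ha : (a : K) ≠ 0 := a.ne_zero
  have hr : (r : K) ≠ 0 := r.ne_zero
  rw [gmn, gmn, inv_upperTriangular_of_mul_eq_one _ m.mul_inv,
    inv_upperTriangular_of_mul_eq_one _ a.inv_mul]
  constructor
  · simp [Matrix.trace_fin_two]
    field_simp
  · have har' : (a : K)⁻¹ * (r : K)⁻¹ ≠ 1 := by
      rwa [← mul_inv, ne_eq, inv_eq_one]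
    convert mul_ne_zero (sub_ne_zero.2 har) (sub_ne_zero.2 har') using 1
    simp [Matrix.det_fin_two]
    field_simp
end
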